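/- For all c₁, c₂, c₃ > 0 there is C > 0 such that for all u, z : ℤ → [0,∞) with ‖u‖_{ℓ²}, ‖z‖_{ℓ²} < ∞: the sum of M₂ · u(j₁) u(j₂) u(j₃) u(k₂) u(k₃) z(k) over all integer tuples with k = k₁+k₂+k₃, k₁ = j₁+j₂+j₃, Φ(k̄) ≠ 0, |Φ(k̄)| ≥ c₁ k* Λ_k, min(|k₁|,|k₂|,|k₃|) ≥ c₂ k*, and Λ_k ≥ c₃ · m_j^{1/100} where m_j denotes the second largest among |j₁|, |j₂|, |j₃|, is at most C ‖u‖⁵_{ℓ²} ‖z‖_{ℓ²}, where M₂ := |k| ⟨k⟩^{1/2} ⟨k₁⟩ / (|Φ(k̄)| ⟨j₁⟩^{1/2} ⟨j₂⟩^{1/2} ⟨j₃⟩^{1/2} ⟨k₂⟩^{1/2} ⟨k₃⟩^{1/2}). -/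

import Mathlib

open scoped ENNReal

/-- Japanese bracket `⟨k⟩ = 1 + |k|`. -/
noncomputable def jb (k : ℤ) : ℝ := 1 + |(k : ℝ)|

/-- `‖u‖_{ℓ²} = (∑_k u(k)²)^{1/2}`, valued in `[0,∞]`. -/
noncomputable def l2 (u : ℤ → ℝ) : ℝ≥0∞ :=
  (∑' k : ℤ, ENNReal.ofReal (u k ^ 2)) ^ (1 / 2 : ℝ)

/-- `Φ(k̄) = k³ − k₁³ − k₂³ − k₃³` with `k = k₁ + k₂ + k₃`. -/
def Phi (k₁ k₂ k₃ : ℤ) : ℤ := (k₁ + k₂ + k₃) ^ 3 - k₁ ^ 3 - k₂ ^ 3 - k₃ ^ 3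

/-- The multiplier `M₂ = |k| ⟨k⟩^s ⟨k₁⟩ / (|Φ(k̄)| ⟨j₁⟩^s ⟨j₂⟩^s ⟨j₃⟩^s ⟨k₂⟩^s ⟨k₃⟩^s)`,
where `k₁ = j₁ + j₂ + j₃` and `k = k₁ + k₂ + k₃`. -/
noncomputable def M2 (s : ℝ) (j₁ j₂ j₃ k₂ k₃ : ℤ) : ℝ :=
  |((j₁ + j₂ + j₃ + k₂ + k₃ : ℤ) : ℝ)| * jb (j₁ + j₂ + j₃ + k₂ + k₃) ^ s *
    jb (j₁ + j₂ + j₃) /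
    (|((Phi (j₁ + j₂ + j₃) k₂ k₃ : ℤ) : ℝ)| *
      jb j₁ ^ s * jb j₂ ^ s * jb j₃ ^ s * jb k₂ ^ s * jb k₃ ^ s)

/-- `k* = max(|k₁|,|k₂|,|k₃|)`. -/
def kstar (k₁ k₂ k₃ : ℤ) : ℤ := max (max |k₁| |k₂|) |k₃|

/-- `λ_k = min(|k₁+k₂|,|k₂+k₃|,|k₃+k₁|)`. -/
def lam (k₁ k₂ k₃ : ℤ) : ℤ := min (min |k₁ + k₂| |k₂ + k₃|) |k₃ + k₁|

/-- `Λ_k = min(|k₁+k₂||k₂+k₃|, |k₂+k₃||k₃+k₁|, |k₃+k₁||k₁+k₂|)`. -/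
def Lam (k₁ k₂ k₃ : ℤ) : ℤ :=
  min (min (|k₁ + k₂| * |k₂ + k₃|) (|k₂ + k₃| * |k₃ + k₁|)) (|k₃ + k₁| * |k₁ + k₂|)

/-- The second largest among `|j₁|, |j₂|, |j₃|`. -/
def secondLargest (j₁ j₂ j₃ : ℤ) : ℤ :=
  max (max (min |j₁| |j₂|) (min |j₂| |j₃|)) (min |j₃| |j₁|)

open Classical in
/-- Summand for the restricted `M₂` estimate: case (e), where `|Φ(k̄)| ≳ k* Λ_k`,
`|k₁| ∼ |k₂| ∼ |k₃| ∼ k*`, and `Λ_k ≳ m_j^{1/100}` with `m_j` the second largest of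
`|j₁|, |j₂|, |j₃|`. -/
noncomputable def term19 (c₁ c₂ c₃ : ℝ) (u z : ℤ → ℝ) (j₁ j₂ j₃ k₂ k₃ : ℤ) : ℝ :=
  let k₁ := j₁ + j₂ + j₃
  let k := k₁ + k₂ + k₃
  if Phi k₁ k₂ k₃ ≠ 0 ∧
      c₁ * ((kstar k₁ k₂ k₃ : ℤ) : ℝ) * ((Lam k₁ k₂ k₃ : ℤ) : ℝ) ≤
        |((Phi k₁ k₂ k₃ : ℤ) : ℝ)| ∧
      c₂ * ((kstar k₁ k₂ k₃ : ℤ) : ℝ) ≤ ((min (min |k₁| |k₂|) |k₃| : ℤ) : ℝ) ∧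
      c₃ * ((secondLargest j₁ j₂ j₃ : ℤ) : ℝ) ^ (1 / 100 : ℝ) ≤
        ((Lam k₁ k₂ k₃ : ℤ) : ℝ) then
    M2 (1 / 2) j₁ j₂ j₃ k₂ k₃ * (u j₁ * u j₂ * u j₃ * u k₂ * u k₃ * z k)
  else 0

theorem one_le_jb (k : ℤ) : 1 ≤ jb k := by
  unfold jb; linarith [abs_nonneg (k : ℝ)]

theorem jb_pos (k : ℤ) : 0 < jb k := one_pos.trans_le (one_le_jb k)

/-- Negative powers of the bracket with exponent below `-1` are summable over `ℤ`. -/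
theorem tsum_jb_rpow_ne_top {r : ℝ} (hr : 1 < r) :
    ∑' k : ℤ, ENNReal.ofReal (jb k ^ (-r)) ≠ ⊤ := by
  have h : Summable fun k : ℤ => jb k ^ (-r) := by
    have h0 := (Real.summable_abs_int_rpow hr).add
      (summable_of_ne_finset_zero (f := fun k : ℤ => if k = 0 then (1 : ℝ) else 0) (s := {0})
        (by intro b hb; simpa using hb))
    refine h0.of_nonneg_of_le (fun k => (Real.rpow_pos_of_pos (jb_pos k) _).le) fun k => ?_
    by_cases hk : k = 0
    · subst hk
      simp [jb, Real.zero_rpow (by linarith : -r ≠ 0)]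
    · have : (0 : ℝ) < |(k : ℝ)| := by positivity
      simp only [hk, if_false, add_zero]
      exact Real.rpow_le_rpow_of_nonpos this (by unfold jb; linarith) (by linarith)
  exact h.tsum_ofReal_ne_top

/-- The Cauchy–Schwarz inequality for series in `[0,∞]`. -/
theorem ENNReal.tsum_mul_le_sqrt_mul_sqrt {ι : Type*} (f g : ι → ℝ≥0∞) :
    ∑' i, f i * g i ≤ (∑' i, f i ^ 2) ^ (1 / 2 : ℝ) * (∑' i, g i ^ 2) ^ (1 / 2 : ℝ) := by
  let : MeasurableSpace ι := ⊤
  have h := ENNReal.lintegral_mul_le_Lp_mul_Lq (MeasureTheory.Measure.count (α := ι))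
    Real.HolderConjugate.two_two (f := f) (g := g) (Measurable.of_discrete).aemeasurable
    (Measurable.of_discrete).aemeasurable
  simpa [MeasureTheory.lintegral_count] using h

/-- A fivefold product of functions, pulled back along an injection, has sum at most the product
of the sums. -/
theorem tsum_mul_five_le (e : ℤ × ℤ × ℤ × ℤ × ℤ → ℤ × ℤ × ℤ × ℤ × ℤ) (he : e.Injective)
    (F₁ F₂ F₃ F₄ F₅ : ℤ → ℝ≥0∞) :
    ∑' q, F₁ (e q).1 * (F₂ (e q).2.1 * (F₃ (e q).2.2.1 *
      (F₄ (e q).2.2.2.1 * F₅ (e q).2.2.2.2))) ≤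
      (∑' n, F₁ n) * ((∑' n, F₂ n) * ((∑' n, F₃ n) * ((∑' n, F₄ n) * ∑' n, F₅ n))) := by
  refine (ENNReal.tsum_comp_le_tsum_of_injective he fun p : ℤ × ℤ × ℤ × ℤ × ℤ =>
    F₁ p.1 * (F₂ p.2.1 * (F₃ p.2.2.1 * (F₄ p.2.2.2.1 * F₅ p.2.2.2.2)))).trans_eq ?_
  simp only [ENNReal.tsum_prod', ENNReal.tsum_mul_left, ENNReal.tsum_mul_right]

theorem Phi_eq (k₁ k₂ k₃ : ℤ) :
    Phi k₁ k₂ k₃ = 3 * ((k₁ + k₂) * (k₂ + k₃) * (k₃ + k₁)) := by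
  unfold Phi; ring

/-- The three pairwise sums of the frequencies. -/
def pairSum (k₁ k₂ k₃ : ℤ) : Fin 3 → ℤ := ![k₁ + k₂, k₂ + k₃, k₃ + k₁]

theorem exists_Lam_eq (k₁ k₂ k₃ : ℤ) :
    ∃ i, Lam k₁ k₂ k₃ = |pairSum k₁ k₂ k₃ i| * |pairSum k₁ k₂ k₃ (i + 1)| := by
  unfold Lam
  rcases min_choice (min (|k₁ + k₂| * |k₂ + k₃|) (|k₂ + k₃| * |k₃ + k₁|))
    (|k₃ + k₁| * |k₁ + k₂|) with h | h
  · rcases min_choice (|k₁ + k₂| * |k₂ + k₃|) (|k₂ + k₃| * |k₃ + k₁|) with h' | h'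
    · exact ⟨0, by rw [h, h']; rfl⟩
    · exact ⟨1, by rw [h, h']; rfl⟩
  · exact ⟨2, by rw [h]; rfl⟩

theorem exists_Lam_bracket {k₁ k₂ k₃ : ℤ} (h : Phi k₁ k₂ k₃ ≠ 0) :
    1 ≤ (Lam k₁ k₂ k₃ : ℝ) ∧
      ∃ i, jb (pairSum k₁ k₂ k₃ i) * jb (pairSum k₁ k₂ k₃ (i + 1)) ≤ 4 * (Lam k₁ k₂ k₃ : ℝ) := by
  obtain ⟨i, hi⟩ := exists_Lam_eq k₁ k₂ k₃
  have hne : ∀ i, 1 ≤ |(pairSum k₁ k₂ k₃ i : ℝ)| := by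
    rw [Phi_eq] at h
    simp only [ne_eq, mul_eq_zero, not_or] at h
    intro i
    have : pairSum k₁ k₂ k₃ i ≠ 0 := by
      fin_cases i
      exacts [h.2.1.1, h.2.1.2, h.2.2]
    exact_mod_cast Int.one_le_abs this
  have h1 := hne i
  have h2 := hne (i + 1)
  rw [hi]
  push_cast
  refine ⟨by nlinarith, i, ?_⟩
  unfold jb
  nlinarith

/-- Among three integers, two are bounded by the second largest modulus and the third controls the
sum. -/
theorem exists_secondLargest (j : Fin 3 → ℤ) :
    ∃ p, |j p| ≤ secondLargest (j 0) (j 1) (j 2) ∧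
      |j (p + 1)| ≤ secondLargest (j 0) (j 1) (j 2) ∧
      |j 0 + j 1 + j 2| ≤ 3 * |j (p + 2)| := by
  have h3 : |j 0 + j 1 + j 2| ≤ |j 0| + |j 1| + |j 2| := abs_add_three _ _ _
  unfold secondLargest
  by_cases h0 : |j 1| ≤ |j 0| ∧ |j 2| ≤ |j 0|
  · exact ⟨1, show |j 1| ≤ _ by omega, show |j 2| ≤ _ by omega,
        show _ ≤ 3 * |j 0| by omega⟩
  · by_cases h1 : |j 0| ≤ |j 1| ∧ |j 2| ≤ |j 1|
    · exact ⟨2, show |j 2| ≤ _ by omega, show |j 0| ≤ _ by omega,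
        show _ ≤ 3 * |j 1| by omega⟩
    · exact ⟨0, show |j 0| ≤ _ by omega, show |j 1| ≤ _ by omega,
        show _ ≤ 3 * |j 2| by omega⟩

/-- The powers of the two smaller inner frequencies needed for summability are absorbed by the
lower bound on `Λ`. -/
theorem rpow_mul_le_sq {c L m x y A : ℝ} (hc : 0 < c) (hL : 1 ≤ L) (hm : 0 ≤ m) (hx : 1 ≤ x)
    (hy : 1 ≤ y) (hA : 0 ≤ A) (hxm : x ≤ 1 + m) (hym : y ≤ 1 + m) (hAL : A ≤ 4 * L)
    (hmL : c * m ^ (1 / 100 : ℝ) ≤ L) :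
    A ^ (3 / 2 : ℝ) * (x ^ (401 / 400 : ℝ) * y ^ (401 / 400 : ℝ)) ≤
      (4 ^ (3 / 2 : ℝ) * (1 + 1 / c) ^ (1 / 2 : ℝ)) * (L ^ 2 * (x * y)) := by
  have hL0 : 0 < L := by linarith
  set D := 1 + 1 / c with hD
  have hD0 : 0 < D := by positivity
  have key : ∀ t : ℝ, 1 ≤ t → t ≤ 1 + m →
      t ^ (401 / 400 : ℝ) ≤ (D ^ (1 / 4 : ℝ) * L ^ (1 / 4 : ℝ)) * t := by
    intro t ht htm
    have h1 : t ^ (1 / 100 : ℝ) ≤ D * L := by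
      calc t ^ (1 / 100 : ℝ) ≤ (1 + m) ^ (1 / 100 : ℝ) := by gcongr
        _ ≤ 1 ^ (1 / 100 : ℝ) + m ^ (1 / 100 : ℝ) :=
          Real.rpow_add_le_add_rpow zero_le_one hm (by norm_num) (by norm_num)
        _ ≤ L + L / c := by
          rw [Real.one_rpow]
          gcongr
          rwa [le_div_iff₀' hc]
        _ = D * L := by rw [hD]; ring
    have h2 : t ^ (401 / 400 : ℝ) = (t ^ (1 / 100 : ℝ)) ^ (1 / 4 : ℝ) * t := by
      rw [← Real.rpow_mul (by linarith)]
      nth_rewrite 3 [← Real.rpow_one t]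
      rw [← Real.rpow_add (by linarith)]
      norm_num
    rw [h2, ← Real.mul_rpow hD0.le hL0.le]
    gcongr
  have hLL : L ^ 2 = L ^ (3 / 2 : ℝ) * (L ^ (1 / 4 : ℝ) * L ^ (1 / 4 : ℝ)) := by
    rw [← Real.rpow_add hL0, ← Real.rpow_add hL0, ← Real.rpow_two]
    norm_num
  have hDD : D ^ (1 / 2 : ℝ) = D ^ (1 / 4 : ℝ) * D ^ (1 / 4 : ℝ) := by
    rw [← Real.rpow_add hD0]
    norm_num
  calc _ ≤ (4 * L) ^ (3 / 2 : ℝ) * (((D ^ (1 / 4 : ℝ) * L ^ (1 / 4 : ℝ)) * x) *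
        ((D ^ (1 / 4 : ℝ) * L ^ (1 / 4 : ℝ)) * y)) := by
        gcongr
        exacts [key x hx hxm, key y hy hym]
    _ = _ := by
      rw [hLL, hDD, Real.mul_rpow (by norm_num) hL0.le]
      ring

/-- The square of the multiplier is controlled by `Λ` and the two smaller inner frequencies. -/
theorem sq_multiplier_le {c₁ c₂ N L k K K₁ K₂ K₃ P x y w : ℝ} (hc₁ : 0 < c₁) (hc₂ : 0 < c₂)
    (hN : 1 ≤ N) (hL : 1 ≤ L) (hx : 0 < x) (hy : 0 < y) (hw : 0 < w) (hk0 : 0 ≤ k)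
    (hk : k ≤ 3 * N) (hK_nonneg : 0 ≤ K) (hK : K ≤ 4 * N) (hK1_nonneg : 0 ≤ K₁) (hK₁ : K₁ ≤ 2 * N)
    (hK₂ : c₂ * N ≤ K₂) (hK₃ : c₂ * N ≤ K₃) (hP : c₁ * N * L ≤ P) (hNw : c₂ * N ≤ 3 * w) :
    k ^ 2 * K * K₁ ^ 2 / (P ^ 2 * (x * y * w) * K₂ * K₃) ≤
      432 / (c₁ ^ 2 * c₂ ^ 3) / (L ^ 2 * (x * y)) := by
  have hN0 : 0 < N := by linarith
  have hL0 : 0 < L := by linarith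
  have hK2_pos : 0 < K₂ := (mul_pos hc₂ hN0).trans_le hK₂
  have hK3_pos : 0 < K₃ := (mul_pos hc₂ hN0).trans_le hK₃
  have hP_pos : 0 < P := (by positivity : 0 < c₁ * N * L).trans_le hP
  calc k ^ 2 * K * K₁ ^ 2 / (P ^ 2 * (x * y * w) * K₂ * K₃)
      ≤ (3 * N) ^ 2 * (4 * N) * (2 * N) ^ 2 /
        ((c₁ * N * L) ^ 2 * (x * y * (c₂ * N / 3)) * (c₂ * N) * (c₂ * N)) := by
        gcongr
        linarith
    _ = _ := by
      field_simp
      norm_num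

/-- The multiplier restricted to case (e). -/
theorem exists_weight (c₁ c₂ c₃ : ℝ) (hc₁ : 0 < c₁) (hc₂ : 0 < c₂) (hc₃ : 0 < c₃) :
    ∃ C > (0 : ℝ), ∀ j₁ j₂ j₃ k₂ k₃ : ℤ, ∃ W : ℝ, 0 ≤ W ∧
      (∀ u z : ℤ → ℝ, term19 c₁ c₂ c₃ u z j₁ j₂ j₃ k₂ k₃ =
        W * (u j₁ * u j₂ * u j₃ * u k₂ * u k₃ * z (j₁ + j₂ + j₃ + k₂ + k₃))) ∧
      W ^ 2 ≤ C * ∑ i, ∑ p,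
        (jb (pairSum (j₁ + j₂ + j₃) k₂ k₃ i) ^ (-(3 / 2) : ℝ) *
          (jb (pairSum (j₁ + j₂ + j₃) k₂ k₃ (i + 1)) ^ (-(3 / 2) : ℝ) *
          (jb (![j₁, j₂, j₃] p) ^ (-(401 / 400) : ℝ) *
            jb (![j₁, j₂, j₃] (p + 1)) ^ (-(401 / 400) : ℝ)))) := by
  have hK : 0 < 4 ^ (3 / 2 : ℝ) * (1 + 1 / c₃) ^ (1 / 2 : ℝ) := by positivity
  set K := 4 ^ (3 / 2 : ℝ) * (1 + 1 / c₃) ^ (1 / 2 : ℝ) with hKdef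
  refine ⟨432 / (c₁ ^ 2 * c₂ ^ 3) * K, by positivity, fun j₁ j₂ j₃ k₂ k₃ => ?_⟩
  have hterm : ∀ i p, 0 ≤ jb (pairSum (j₁ + j₂ + j₃) k₂ k₃ i) ^ (-(3 / 2) : ℝ) *
          (jb (pairSum (j₁ + j₂ + j₃) k₂ k₃ (i + 1)) ^ (-(3 / 2) : ℝ) *
          (jb (![j₁, j₂, j₃] p) ^ (-(401 / 400) : ℝ) *
            jb (![j₁, j₂, j₃] (p + 1)) ^ (-(401 / 400) : ℝ))) := fun i p => by
    have := fun n r => (Real.rpow_pos_of_pos (jb_pos n) r).le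
    exact mul_nonneg (this _ _) (mul_nonneg (this _ _) (mul_nonneg (this _ _) (this _ _)))
  unfold term19
  by_cases hcond : Phi (j₁ + j₂ + j₃) k₂ k₃ ≠ 0 ∧
      c₁ * ((kstar (j₁ + j₂ + j₃) k₂ k₃ : ℤ) : ℝ) * ((Lam (j₁ + j₂ + j₃) k₂ k₃ : ℤ) : ℝ) ≤
        |((Phi (j₁ + j₂ + j₃) k₂ k₃ : ℤ) : ℝ)| ∧
      c₂ * ((kstar (j₁ + j₂ + j₃) k₂ k₃ : ℤ) : ℝ) ≤
        ((min (min |j₁ + j₂ + j₃| |k₂|) |k₃| : ℤ) : ℝ) ∧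
      c₃ * ((secondLargest j₁ j₂ j₃ : ℤ) : ℝ) ^ (1 / 100 : ℝ) ≤
        ((Lam (j₁ + j₂ + j₃) k₂ k₃ : ℤ) : ℝ)
  swap
  · exact ⟨0, le_rfl, fun u z => by simp only [if_neg hcond, zero_mul],
      by have := Finset.sum_nonneg fun i (_ : i ∈ Finset.univ) =>
            Finset.sum_nonneg fun p (_ : p ∈ Finset.univ) => hterm i p
         rw [zero_pow two_ne_zero]; positivity⟩
  have hrp : ∀ n (r : ℝ), 0 < jb n ^ r := fun n r => Real.rpow_pos_of_pos (jb_pos n) r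
  refine ⟨M2 (1 / 2) j₁ j₂ j₃ k₂ k₃, ?_, fun u z => by simp only [if_pos hcond], ?_⟩
  · unfold M2
    have h0 := jb_pos (j₁ + j₂ + j₃)
    have h1 := fun n => (hrp n (1 / 2)).le
    exact div_nonneg (mul_nonneg (mul_nonneg (abs_nonneg _) (h1 _)) h0.le)
      (mul_nonneg (mul_nonneg (mul_nonneg (mul_nonneg (mul_nonneg (abs_nonneg _) (h1 _)) (h1 _))
        (h1 _)) (h1 _)) (h1 _))
  obtain ⟨hPhi, hc1, hc2, hc3⟩ := hcond
  obtain ⟨hL, i, hi⟩ := exists_Lam_bracket hPhi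
  obtain ⟨p, hp, hp1, hp2⟩ := exists_secondLargest ![j₁, j₂, j₃]
  simp only [Matrix.cons_val_zero, Matrix.cons_val_one, Matrix.cons_val] at hp hp1 hp2
  refine le_trans ?_ (mul_le_mul_of_nonneg_left
    ((Finset.single_le_sum (fun p _ => hterm i p) (Finset.mem_univ p)).trans
      (Finset.single_le_sum (f := fun i => ∑ p, _)
        (fun i _ => Finset.sum_nonneg fun p _ => hterm i p) (Finset.mem_univ i))) (by positivity))
  have hsq : ∀ n, (jb n ^ (1 / 2 : ℝ)) ^ 2 = jb n := fun n => by
    rw [← Real.sqrt_eq_rpow, Real.sq_sqrt (jb_pos n).le]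
  have hprod : jb j₁ * jb j₂ * jb j₃ = jb (![j₁, j₂, j₃] p) * jb (![j₁, j₂, j₃] (p + 1)) *
      jb (![j₁, j₂, j₃] (p + 2)) := by
    fin_cases p <;> simp <;> ring
  have hM : M2 (1 / 2) j₁ j₂ j₃ k₂ k₃ ^ 2 =
      |((j₁ + j₂ + j₃ + k₂ + k₃ : ℤ) : ℝ)| ^ 2 * jb (j₁ + j₂ + j₃ + k₂ + k₃) *
        jb (j₁ + j₂ + j₃) ^ 2 / (|((Phi (j₁ + j₂ + j₃) k₂ k₃ : ℤ) : ℝ)| ^ 2 *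
          (jb (![j₁, j₂, j₃] p) * jb (![j₁, j₂, j₃] (p + 1)) *
      jb (![j₁, j₂, j₃] (p + 2))) * jb k₂ * jb k₃) := by
    rw [← hprod]
    unfold M2
    simp only [div_pow, mul_pow, hsq]
    ring
  have hkstar : 1 ≤ kstar (j₁ + j₂ + j₃) k₂ k₃ := by
    by_contra hlt
    unfold kstar at hlt
    have h1 : j₁ + j₂ + j₃ = 0 := abs_nonpos_iff.mp (by omega)
    have h2 : k₂ = 0 := abs_nonpos_iff.mp (by omega)
    have h3 : k₃ = 0 := abs_nonpos_iff.mp (by omega)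
    exact hPhi (by rw [h1, h2, h3]; rfl)
  have hN : (1 : ℝ) ≤ (kstar (j₁ + j₂ + j₃) k₂ k₃ : ℤ) := by exact_mod_cast hkstar
  have hk : |((j₁ + j₂ + j₃ + k₂ + k₃ : ℤ) : ℝ)| ≤ 3 * (kstar (j₁ + j₂ + j₃) k₂ k₃ : ℤ) := by
    have : |j₁ + j₂ + j₃ + k₂ + k₃| ≤ 3 * kstar (j₁ + j₂ + j₃) k₂ k₃ := by
      have := abs_add_three (j₁ + j₂ + j₃) k₂ k₃
      unfold kstar; omega
    exact_mod_cast this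
  have hk1 : |((j₁ + j₂ + j₃ : ℤ) : ℝ)| ≤ (kstar (j₁ + j₂ + j₃) k₂ k₃ : ℤ) := by
    have : |j₁ + j₂ + j₃| ≤ kstar (j₁ + j₂ + j₃) k₂ k₃ := by
      unfold kstar; omega
    exact_mod_cast this
  have hmin : ∀ n : ℤ, min (min |j₁ + j₂ + j₃| |k₂|) |k₃| ≤ |n| →
      c₂ * ((kstar (j₁ + j₂ + j₃) k₂ k₃ : ℤ) : ℝ) ≤ |(n : ℝ)| := fun n hn =>
    hc2.trans (by exact_mod_cast hn)
  have hmul := sq_multiplier_le (x := jb (![j₁, j₂, j₃] p)) (y := jb (![j₁, j₂, j₃] (p + 1)))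
    (w := jb (![j₁, j₂, j₃] (p + 2))) (K := jb (j₁ + j₂ + j₃ + k₂ + k₃))
    (K₁ := jb (j₁ + j₂ + j₃)) (K₂ := jb k₂) (K₃ := jb k₃) hc₁ hc₂ hN hL
    (jb_pos _) (jb_pos _) (jb_pos _) (abs_nonneg _) hk (jb_pos _).le (by unfold jb; linarith) (jb_pos _).le
    (by unfold jb; linarith)
    (by unfold jb; linarith [hmin k₂ (by omega)]) (by unfold jb; linarith [hmin k₃ (by omega)]) hc1
    (by
      have h1 := hmin (j₁ + j₂ + j₃) (by omega)
      have h2 : |((j₁ + j₂ + j₃ : ℤ) : ℝ)| ≤ 3 * |((![j₁, j₂, j₃] (p + 2) : ℤ) : ℝ)| := by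
        exact_mod_cast hp2
      unfold jb; linarith)
  have hpR : |((![j₁, j₂, j₃] p : ℤ) : ℝ)| ≤ (secondLargest j₁ j₂ j₃ : ℤ) := by exact_mod_cast hp
  have hp1R : |((![j₁, j₂, j₃] (p + 1) : ℤ) : ℝ)| ≤ (secondLargest j₁ j₂ j₃ : ℤ) := by
    exact_mod_cast hp1
  have hpow := rpow_mul_le_sq hc₃ hL ((abs_nonneg _).trans hpR) (one_le_jb _) (one_le_jb _)
    (mul_nonneg (jb_pos _).le (jb_pos _).le) (add_le_add_right hpR 1) (add_le_add_right hp1R 1)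
    hi hc3
  rw [← hKdef] at hpow
  rw [hM]
  refine hmul.trans ?_
  have hxy := mul_pos (jb_pos (![j₁, j₂, j₃] p)) (jb_pos (![j₁, j₂, j₃] (p + 1)))
  rw [Real.mul_rpow (jb_pos _).le (jb_pos _).le] at hpow
  simp only [Real.rpow_neg (jb_pos _).le, ← mul_inv]
  change _ ≤ 432 / (c₁ ^ 2 * c₂ ^ 3) * K * _
  rw [mul_assoc, div_eq_mul_inv (432 / (c₁ ^ 2 * c₂ ^ 3))]
  refine mul_le_mul_of_nonneg_left ?_ (by positivity)
  rw [← div_eq_mul_inv, ← mul_assoc (jb (pairSum _ _ _ _) ^ _),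
    le_div_iff₀ (mul_pos (mul_pos (hrp _ _) (hrp _ _)) (mul_pos (hrp _ _) (hrp _ _))), inv_mul_le_iff₀ (by positivity), mul_comm _ K]
  exact hpow

theorem sum_injective (i p : Fin 3) : Function.Injective fun q : ℤ × ℤ × ℤ × ℤ × ℤ =>
    (q.1 + q.2.1 + q.2.2.1 + q.2.2.2.1 + q.2.2.2.2,
      pairSum (q.1 + q.2.1 + q.2.2.1) q.2.2.2.1 q.2.2.2.2 i,
      pairSum (q.1 + q.2.1 + q.2.2.1) q.2.2.2.1 q.2.2.2.2 (i + 1),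
      ![q.1, q.2.1, q.2.2.1] p, ![q.1, q.2.1, q.2.2.1] (p + 1)) := by
  rintro ⟨a, b, c, d, e⟩ ⟨a', b', c', d', e'⟩ h
  simp only [Prod.mk.injEq] at h ⊢
  fin_cases i <;> fin_cases p <;> simp [pairSum] at h <;> omega

/-- Restricted quintic `M₂` estimate at `s = 1/2`, case (e). -/
theorem M2_restricted_e (c₁ c₂ c₃ : ℝ) (hc₁ : 0 < c₁) (hc₂ : 0 < c₂) (hc₃ : 0 < c₃) :
    ∃ C > (0 : ℝ), ∀ u z : ℤ → ℝ, (∀ k, 0 ≤ u k) → (∀ k, 0 ≤ z k) →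
      l2 u < ⊤ → l2 z < ⊤ →
      (∑' q : ℤ × ℤ × ℤ × ℤ × ℤ,
        ENNReal.ofReal (term19 c₁ c₂ c₃ u z q.1 q.2.1 q.2.2.1 q.2.2.2.1 q.2.2.2.2)) ≤
        ENNReal.ofReal C * l2 u ^ 5 * l2 z := by
  obtain ⟨C, hC, hW⟩ := exists_weight c₁ c₂ c₃ hc₁ hc₂ hc₃
  choose W hW0 hterm hWsq using hW
  set G : ℝ≥0∞ := ∑' k : ℤ, ENNReal.ofReal (jb k ^ (-(3 / 2) : ℝ)) with hG
  set H : ℝ≥0∞ := ∑' k : ℤ, ENNReal.ofReal (jb k ^ (-(401 / 400) : ℝ)) with hH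
  have hGtop : G ≠ ⊤ := tsum_jb_rpow_ne_top (by norm_num)
  have hHtop : H ≠ ⊤ := tsum_jb_rpow_ne_top (by norm_num)
  set D : ℝ≥0∞ := ENNReal.ofReal C * (9 * (G * (G * (H * H)))) with hD
  have hDtop : D ^ (1 / 2 : ℝ) ≠ ⊤ := by
    refine ENNReal.rpow_ne_top_of_nonneg (by norm_num) ?_
    finiteness
  refine ⟨(D ^ (1 / 2 : ℝ)).toReal + 1, by positivity, fun u z hu hz _ _ => ?_⟩
  have hsplit : ∀ q : ℤ × ℤ × ℤ × ℤ × ℤ,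
      ENNReal.ofReal (term19 c₁ c₂ c₃ u z q.1 q.2.1 q.2.2.1 q.2.2.2.1 q.2.2.2.2) =
      ENNReal.ofReal (u q.1 * u q.2.1 * u q.2.2.1 * u q.2.2.2.1 * u q.2.2.2.2) *
      ENNReal.ofReal (W q.1 q.2.1 q.2.2.1 q.2.2.2.1 q.2.2.2.2 *
        z (q.1 + q.2.1 + q.2.2.1 + q.2.2.2.1 + q.2.2.2.2)) := fun q => by
    have h0 : 0 ≤ u q.1 * u q.2.1 * u q.2.2.1 * u q.2.2.2.1 * u q.2.2.2.2 := by
      exact mul_nonneg (mul_nonneg (mul_nonneg (mul_nonneg (hu _) (hu _)) (hu _)) (hu _)) (hu _)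
    rw [← ENNReal.ofReal_mul h0, hterm]
    congr 1
    ring
  simp only [hsplit]
  refine (ENNReal.tsum_mul_le_sqrt_mul_sqrt _ _).trans ?_
  have hU : ∑' q : ℤ × ℤ × ℤ × ℤ × ℤ,
      ENNReal.ofReal (u q.1 * u q.2.1 * u q.2.2.1 * u q.2.2.2.1 * u q.2.2.2.2) ^ 2 ≤
      (∑' k, ENNReal.ofReal (u k ^ 2)) ^ 5 := by
    have h := tsum_mul_five_le id Function.injective_id (fun k => ENNReal.ofReal (u k ^ 2))
      (fun k => ENNReal.ofReal (u k ^ 2)) (fun k => ENNReal.ofReal (u k ^ 2))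
      (fun k => ENNReal.ofReal (u k ^ 2)) (fun k => ENNReal.ofReal (u k ^ 2))
    refine le_trans (le_of_eq ?_) (h.trans_eq (by ring))
    refine tsum_congr fun q => ?_
    simp only [id, ENNReal.ofReal_mul' (hu _), ENNReal.ofReal_pow (hu _)]
    ring
  have hZ : ∑' q : ℤ × ℤ × ℤ × ℤ × ℤ,
      ENNReal.ofReal (W q.1 q.2.1 q.2.2.1 q.2.2.2.1 q.2.2.2.2 *
        z (q.1 + q.2.1 + q.2.2.1 + q.2.2.2.1 + q.2.2.2.2)) ^ 2 ≤
      D * ∑' k, ENNReal.ofReal (z k ^ 2) := by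
    have hpt : ∀ q : ℤ × ℤ × ℤ × ℤ × ℤ,
        ENNReal.ofReal (W q.1 q.2.1 q.2.2.1 q.2.2.2.1 q.2.2.2.2 *
          z (q.1 + q.2.1 + q.2.2.1 + q.2.2.2.1 + q.2.2.2.2)) ^ 2 ≤
        ENNReal.ofReal C * ∑ i, ∑ p,
          ENNReal.ofReal (z (q.1 + q.2.1 + q.2.2.1 + q.2.2.2.1 + q.2.2.2.2) ^ 2) *
          (ENNReal.ofReal
            (jb (pairSum (q.1 + q.2.1 + q.2.2.1) q.2.2.2.1 q.2.2.2.2 i) ^ (-(3 / 2) : ℝ)) *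
          (ENNReal.ofReal
            (jb (pairSum (q.1 + q.2.1 + q.2.2.1) q.2.2.2.1 q.2.2.2.2 (i + 1)) ^ (-(3 / 2) : ℝ)) *
          (ENNReal.ofReal (jb (![q.1, q.2.1, q.2.2.1] p) ^ (-(401 / 400) : ℝ)) *
            ENNReal.ofReal (jb (![q.1, q.2.1, q.2.2.1] (p + 1)) ^ (-(401 / 400) : ℝ))))) := by
      intro q
      have hrp : ∀ n (r : ℝ), 0 ≤ jb n ^ r := fun n r => (Real.rpow_pos_of_pos (jb_pos n) r).le
      have h := ENNReal.ofReal_le_ofReal (hWsq q.1 q.2.1 q.2.2.1 q.2.2.2.1 q.2.2.2.2)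
      rw [ENNReal.ofReal_mul hC.le, ENNReal.ofReal_sum_of_nonneg (fun i _ =>
        Finset.sum_nonneg fun p _ => mul_nonneg (hrp _ _) (mul_nonneg (hrp _ _)
          (mul_nonneg (hrp _ _) (hrp _ _))))] at h
      simp only [ENNReal.ofReal_sum_of_nonneg (fun p _ => mul_nonneg (hrp _ _)
        (mul_nonneg (hrp _ _) (mul_nonneg (hrp _ _) (hrp _ _)))),
        ENNReal.ofReal_mul (hrp _ _)] at h
      rw [← ENNReal.ofReal_pow (mul_nonneg (hW0 _ _ _ _ _) (hz _)), mul_pow,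
        ENNReal.ofReal_mul (sq_nonneg _)]
      simp only [← Finset.mul_sum]
      simp only [← Finset.mul_sum] at h
      calc _ ≤ _ := mul_le_mul_left h _
        _ = _ := by ring
    refine (ENNReal.tsum_le_tsum hpt).trans ?_
    rw [ENNReal.tsum_mul_left, Summable.tsum_finsetSum (fun _ _ => ENNReal.summable), hD, mul_assoc]
    refine mul_le_mul_right ?_ _
    calc _ ≤ ∑ _i : Fin 3, ∑ _p : Fin 3,
          (∑' k, ENNReal.ofReal (z k ^ 2)) * (G * (G * (H * H))) := by
          refine Finset.sum_le_sum fun i _ => ?_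
          rw [Summable.tsum_finsetSum (fun _ _ => ENNReal.summable)]
          refine Finset.sum_le_sum fun p _ => ?_
          exact tsum_mul_five_le _ (sum_injective i p) (fun k => ENNReal.ofReal (z k ^ 2))
            (fun k => ENNReal.ofReal (jb k ^ (-(3 / 2) : ℝ)))
            (fun k => ENNReal.ofReal (jb k ^ (-(3 / 2) : ℝ)))
            (fun k => ENNReal.ofReal (jb k ^ (-(401 / 400) : ℝ)))
            (fun k => ENNReal.ofReal (jb k ^ (-(401 / 400) : ℝ)))
      _ = _ := by
        simp only [Finset.sum_const, Finset.card_univ, Fintype.card_fin, nsmul_eq_mul]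
        push_cast
        ring
  have hl2 : ((∑' k, ENNReal.ofReal (u k ^ 2)) ^ 5) ^ (1 / 2 : ℝ) = l2 u ^ 5 := by
    unfold l2
    rw [← ENNReal.rpow_natCast, ← ENNReal.rpow_natCast, ← ENNReal.rpow_mul, ← ENNReal.rpow_mul,
      mul_comm]
  calc _ ≤ ((∑' k, ENNReal.ofReal (u k ^ 2)) ^ 5) ^ (1 / 2 : ℝ) *
        (D * ∑' k, ENNReal.ofReal (z k ^ 2)) ^ (1 / 2 : ℝ) := by gcongr
    _ = D ^ (1 / 2 : ℝ) * l2 u ^ 5 * l2 z := by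
      rw [hl2, ENNReal.mul_rpow_of_nonneg _ _ (by norm_num : (0 : ℝ) ≤ 1 / 2)]
      unfold l2
      ring
    _ ≤ _ := by
      gcongr
      calc D ^ (1 / 2 : ℝ) = ENNReal.ofReal (D ^ (1 / 2 : ℝ)).toReal :=
            (ENNReal.ofReal_toReal hDtop).symm
        _ ≤ _ := ENNReal.ofReal_le_ofReal (by linarith)
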